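/- Let k be a field, let A be an integral domain that is a k-algebra, let φ be a nontrivial exponential map on A (i.e. not the constant-polynomial inclusion), let D = {D^i} be the associated higher derivation, let x ∈ A be an element of minimal positive φ-degree n, and set c = D^n(x) (a nonzero element of A^φ). Then, inside the fraction field of A, every element a ∈ A can be written as a polynomial in x whose coefficients lie in the localization A^φ[c^{-1}]; that is, A is contained in the subring A^φ[c^{-1}][x] of Frac(A). -/

import Mathlib

open Polynomial TensorProduct

/-- An *exponential map* on a commutative `k`-algebra `A` is a `k`-algebra homomorphism
`φ : A → A[t]` such that evaluation at `t = 0` composed with `φ` is the identity, and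
applying `φ` coefficientwise to `φ a` equals substituting `s + t` for `t` in `φ a`. -/
def IsExponential {k A : Type*} [CommRing k] [CommRing A] [Algebra k A]
    (φ : A →ₐ[k] A[X]) : Prop :=
  (∀ a : A, (φ a).eval 0 = a) ∧
  (∀ a : A, (φ a).map (φ : A →+* A[X]) =
      (φ a).eval₂ ((C : A[X] →+* A[X][X]).comp (C : A →+* A[X])) (X + C X))

/-- The ring of `φ`-invariants `A^φ = {a : A | φ a = C a}`. -/
noncomputable def expInvariants {k A : Type*} [CommRing k] [CommRing A] [Algebra k A]
    (φ : A →ₐ[k] A[X]) : Subalgebra k A :=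
  AlgHom.equalizer φ ((Algebra.ofId A A[X]).restrictScalars k)

/-- The AK invariant (ring of absolute constants) of a commutative `k`-algebra `A`:
the intersection of `A^φ` over all exponential maps `φ` on `A`. -/
noncomputable def AK (k A : Type*) [CommRing k] [CommRing A] [Algebra k A] : Subalgebra k A :=
  ⨅ φ : {ψ : A →ₐ[k] A[X] // IsExponential ψ}, expInvariants φ.1

/-- `A` has transcendence degree 1 over `k`: some single element is a transcendence basis. -/
def TrdegOne (k A : Type*) [CommRing k] [CommRing A] [Algebra k A] : Prop :=
  ∃ x : A, IsTranscendenceBasis k (fun _ : Unit => x)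

/-- Pseudo-division: some multiple of `p` by a power of the leading coefficient of `g` can be
divided by `g` with remainder. -/
theorem Polynomial.exists_leadingCoeff_pow_mul_eq {R : Type*} [CommRing R] [IsDomain R]
    (g : R[X]) (hg : 0 < g.natDegree) (p : R[X]) :
    ∃ (N : ℕ) (q r : R[X]), C (g.leadingCoeff ^ N) * p = q * g + r ∧ r.degree < g.degree := by
  induction h : p.natDegree using Nat.strong_induction_on generalizing p with
  | _ m ih =>
    have hg0 : g ≠ 0 := by rintro rfl; simp at hg
    by_cases hpg : p.natDegree < g.natDegree
    · exact ⟨0, 0, p, by simp, degree_lt_degree hpg⟩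
    · have hle : g.natDegree ≤ p.natDegree := not_lt.mp hpg
      obtain ⟨N, q, r, hqr, hr⟩ := ih _
        (h ▸ natDegree_cancelLeads_lt_of_natDegree_le_natDegree hle (hg.trans_le hle)) _ rfl
      refine ⟨N + 1, q + C (g.leadingCoeff ^ N) * C p.leadingCoeff *
        X ^ (p.natDegree - g.natDegree), r, ?_, hr⟩
      rw [cancelLeads, Nat.sub_eq_zero_of_le hle, pow_zero, mul_one] at hqr
      rw [pow_succ, C_mul]
      linear_combination hqr

/-- Quotient and remainder are unique in a division over a domain. -/
theorem Polynomial.eq_and_eq_of_mul_add_eq_mul_add {R : Type*} [CommRing R] [IsDomain R]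
    {g q₁ q₂ r₁ r₂ : R[X]} (h : q₁ * g + r₁ = q₂ * g + r₂)
    (h₁ : r₁.degree < g.degree) (h₂ : r₂.degree < g.degree) : q₁ = q₂ ∧ r₁ = r₂ := by
  have hq : q₁ = q₂ := by
    by_contra hne
    have hdvd : g ∣ r₂ - r₁ := ⟨q₁ - q₂, by linear_combination -h⟩
    have hr : r₂ - r₁ = 0 :=
      eq_zero_of_dvd_of_degree_lt hdvd ((degree_sub_le _ _).trans_lt (max_lt h₂ h₁))
    have hmul : (q₁ - q₂) * g = 0 := by linear_combination h + hr
    rcases mul_eq_zero.mp hmul with h0 | h0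
    · exact hne (sub_eq_zero.mp h0)
    · simp [h0] at h₁
  subst hq
  exact ⟨rfl, add_left_cancel h⟩

/-- Substitution of `s + t` for `t`, where `s` is the variable of the inner polynomial ring. -/
noncomputable def Polynomial.translate (A : Type*) [CommRing A] : A[X] →+* A[X][X] :=
  eval₂RingHom ((C : A[X] →+* A[X][X]).comp (C : A →+* A[X])) (X + C X)

namespace Polynomial

variable {A : Type*} [CommRing A]

theorem translate_eq_taylor (p : A[X]) : translate A p = taylor X (p.map C) := by
  rw [translate, coe_eval₂RingHom, taylor_apply, comp, eval₂_map]

theorem degree_translate (p : A[X]) : (translate A p).degree = p.degree := by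
  rw [translate_eq_taylor, degree_taylor, degree_map_eq_of_injective C_injective]

theorem leadingCoeff_translate (p : A[X]) :
    (translate A p).leadingCoeff = C p.leadingCoeff := by
  rw [translate_eq_taylor, leadingCoeff_taylor, leadingCoeff_map_of_injective C_injective]

theorem coeff_zero_translate (p : A[X]) : (translate A p).coeff 0 = p := by
  rw [translate_eq_taylor, taylor_coeff_zero, eval_map, eval₂_C_X]

end Polynomial

section Exponential

variable {k A : Type*} [CommRing k] [CommRing A] [Algebra k A] {φ : A →ₐ[k] A[X]}

theorem mem_expInvariants {a : A} : a ∈ expInvariants φ ↔ φ a = C a := Iff.rfl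

theorem IsExponential.injective (hφ : IsExponential φ) :
    Function.Injective (φ : A →+* A[X]) :=
  Function.LeftInverse.injective (g := eval 0) hφ.1

theorem IsExponential.mem_expInvariants_of_degree_le (hφ : IsExponential φ) {a : A}
    (ha : (φ a).degree ≤ 0) : a ∈ expInvariants φ := by
  have h := hφ.1 a
  rw [eq_C_of_degree_le_zero ha, eval_C] at h
  rw [mem_expInvariants, eq_C_of_degree_le_zero ha, h]

theorem IsExponential.map_eq_translate (hφ : IsExponential φ) (a : A) :
    (φ a).map (φ : A →+* A[X]) = translate A (φ a) := hφ.2 a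

theorem IsExponential.leadingCoeff_mem_expInvariants (hφ : IsExponential φ) (a : A) :
    (φ a).leadingCoeff ∈ expInvariants φ := by
  have h := congrArg leadingCoeff (hφ.map_eq_translate a)
  rwa [leadingCoeff_translate, leadingCoeff_map_of_injective hφ.injective] at h

theorem map_coeff_zero_of_map_eq_translate {p : A[X]}
    (hp : p.map (φ : A →+* A[X]) = translate A p) : φ (p.coeff 0) = p := by
  have h := congrArg (fun P => coeff P 0) hp
  beta_reduce at h
  rwa [coeff_map, coeff_zero_translate] at h

/-- Pseudo-division of `φ a` by `φ x` descends to `A`. -/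
theorem IsExponential.exists_leadingCoeff_pow_mul_eq [IsDomain A] (hφ : IsExponential φ) {x : A}
    (hx : 0 < (φ x).degree) (a : A) :
    ∃ (N : ℕ) (q r : A), (φ x).leadingCoeff ^ N * a = q * x + r ∧
      (φ r).degree < (φ x).degree := by
  obtain ⟨N, q, r, hqr, hr⟩ :=
    (φ x).exists_leadingCoeff_pow_mul_eq (natDegree_pos_iff_degree_pos.mpr hx) (φ a)
  have hc : φ ((φ x).leadingCoeff ^ N) = C ((φ x).leadingCoeff ^ N) :=
    pow_mem (hφ.leadingCoeff_mem_expInvariants x) N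
  rw [← hc, ← map_mul] at hqr
  have h := hφ.map_eq_translate ((φ x).leadingCoeff ^ N * a)
  rw [hqr, Polynomial.map_add, Polynomial.map_mul, map_add, map_mul, hφ.map_eq_translate x] at h
  obtain ⟨hq', hr'⟩ := eq_and_eq_of_mul_add_eq_mul_add h
    (by rwa [degree_map_eq_of_injective hφ.injective, degree_translate])
    (by rwa [degree_translate, degree_translate])
  have hq := map_coeff_zero_of_map_eq_translate hq'
  have hr₀ := map_coeff_zero_of_map_eq_translate hr'
  refine ⟨N, q.coeff 0, r.coeff 0, hφ.injective ?_, by rwa [hr₀]⟩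
  change φ _ = φ _
  rw [hqr, map_add, map_mul φ, hq, hr₀]

end Exponential

/-- **Lemma 2(c).** With `x` of minimal positive `φ`-degree `n` and `c = Dⁿ(x)`, inside
the fraction field of `A` every element of `A` lies in `A^φ[c⁻¹][x]`. -/
theorem mem_adjoin_invariants_inv_c_x
    {k A K : Type*} [Field k] [CommRing A] [IsDomain A] [Algebra k A]
    [Field K] [Algebra A K] [IsFractionRing A K] [Algebra k K] [IsScalarTower k A K]
    (φ : A →ₐ[k] A[X]) (hφ : IsExponential φ) (hnt : ∃ a : A, φ a ≠ C a)
    (x : A) (hx : 0 < (φ x).degree)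
    (hmin : ∀ a : A, 0 < (φ a).degree → (φ x).degree ≤ (φ a).degree) :
    ∀ a : A, algebraMap A K a ∈
      Algebra.adjoin k
        ((algebraMap A K) '' (expInvariants φ : Set A) ∪
          {(algebraMap A K ((φ x).coeff (φ x).natDegree))⁻¹, algebraMap A K x}) := by
  set c := (φ x).leadingCoeff with hc
  have hc0 : algebraMap A K c ≠ 0 := by
    rw [Ne, FaithfulSMul.algebraMap_eq_zero_iff, leadingCoeff_eq_zero]
    exact ne_zero_of_degree_gt hx
  have hcinv : φ c = C c := hφ.leadingCoeff_mem_expInvariants x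
  change ∀ a : A, algebraMap A K a ∈ Algebra.adjoin k
    ((algebraMap A K) '' (expInvariants φ : Set A) ∪
      {(algebraMap A K c)⁻¹, algebraMap A K x})
  set B := Algebra.adjoin k ((algebraMap A K) '' (expInvariants φ : Set A) ∪
      {(algebraMap A K c)⁻¹, algebraMap A K x})
  have hinv : ∀ r : A, (φ r).degree < (φ x).degree → algebraMap A K r ∈ B := fun r hr =>
    Algebra.subset_adjoin <| .inl <| Set.mem_image_of_mem _ <|
      hφ.mem_expInvariants_of_degree_le <| not_lt.mp fun h => (hmin r h).not_gt hr
  have hcB : (algebraMap A K c)⁻¹ ∈ B := Algebra.subset_adjoin (by simp)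
  have hxB : algebraMap A K x ∈ B := Algebra.subset_adjoin (by simp)
  intro a
  induction hd : (φ a).natDegree using Nat.strong_induction_on generalizing a with
  | _ m ih =>
    by_cases hlt : (φ a).degree < (φ x).degree
    · exact hinv a hlt
    obtain ⟨N, q, r, hqr, hr⟩ := hφ.exists_leadingCoeff_pow_mul_eq hx a
    have hqB : algebraMap A K q ∈ B := by
      rcases eq_or_ne (φ q) 0 with hq | hq
      · exact hinv q (by rw [hq, degree_zero]; exact bot_lt_of_lt hx)
      · refine ih _ ?_ q rfl
        have hmul : φ q * φ x = C (c ^ N) * φ a - φ r := by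
          rw [C_pow, ← hcinv, ← map_pow, ← map_mul, ← map_mul, ← map_sub, hqr, add_sub_cancel_right]
        have hn := natDegree_mul hq (ne_zero_of_degree_gt hx)
        have hle : (φ q * φ x).natDegree ≤ (φ a).natDegree := by
          rw [hmul]
          refine (natDegree_sub_le _ _).trans (max_le (natDegree_C_mul_le _ _) ?_)
          exact natDegree_le_natDegree (hr.le.trans (not_lt.mp hlt))
        have := natDegree_pos_iff_degree_pos.mpr hx
        omega
    have ha : algebraMap A K a = (algebraMap A K c)⁻¹ ^ N *
        (algebraMap A K q * algebraMap A K x + algebraMap A K r) := by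
      rw [← map_mul, ← map_add, ← hqr, map_mul, map_pow, ← mul_assoc, ← mul_pow,
        inv_mul_cancel₀ hc0, one_pow, one_mul]
    rw [ha]
    exact mul_mem (pow_mem hcB N) (add_mem (mul_mem hqB hxB) (hinv r hr))
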